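/- Let U be a finite set of Boolean variables and C = {c₁,…,c_n} a collection of clauses over U with exactly three literals per clause, and let Σ, a, b be the alphabet and the two strings produced by the reduction construction (truth-setting variable blocks u^{i₁}⋯u^{i_m} ū^{i₁}⋯ū^{i_m} in a versus ū^{i₁}⋯ū^{i_m} u^{i₁}⋯u^{i_m} in b for each variable, followed by the boundary symbol •, followed for each clause c_i = {x,y,z} by the block x^i y^i z^i x̄^i ȳ^i z̄^i in a versus x^i y^i z^i ȳ^i x̄^i z̄^i ȳ^i in b). Then there exists a permutation of Σ that is a common subsequence of a and b if and only if C is satisfiable. -/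

import Mathlib

namespace CommonPerm

/-! ## The reduction from 3SAT to Common Permutation -/

/-- A literal over variables `Fin m`: a variable together with a sign
(`true` = positive literal `u`, `false` = negated literal `¬u`). -/
abbrev Lit (m : ℕ) := Fin m × Bool

/-- A 3-clause: an (ordered) triple of literals `(x, y, z)`. -/
abbrev Clause (m : ℕ) := Lit m × Lit m × Lit m

/-- The symbols of the alphabet `Σ`: `none` is the boundary symbol `•`, and
`some (u, i, true)` (resp. `some (u, i, false)`) is the symbol `u^i` (resp. `ū^i`). -/
abbrev Symb (m n : ℕ) := Option (Fin m × Fin n × Bool)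

/-- The variable `u` occurs (positively or negatively) in clause `C i`. -/
abbrev OccursIn {m n : ℕ} (C : Fin n → Clause m) (u : Fin m) (i : Fin n) : Prop :=
  (C i).1.1 = u ∨ (C i).2.1.1 = u ∨ (C i).2.2.1 = u

/-- Membership in the alphabet `Σ`: the boundary symbol, together with `u^i`, `ū^i`
for every variable `u` and every clause `c_i` in which `u` appears. -/
def InSigma {m n : ℕ} (C : Fin n → Clause m) : Symb m n → Prop
  | none => True
  | some (u, i, _) => OccursIn C u i

instance {m n : ℕ} (C : Fin n → Clause m) : DecidablePred (InSigma C) := fun s =>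
  match s with
  | none => .isTrue trivial
  | some (_, _, _) => inferInstanceAs (Decidable (_ ∨ _ ∨ _))

/-- The indices `i₁ < ⋯ < i_m` of the clauses in which the variable `u` appears. -/
def clausesOf {m n : ℕ} (C : Fin n → Clause m) (u : Fin m) : List (Fin n) :=
  (List.finRange n).filter fun i => decide (OccursIn C u i)

/-- The truth-setting block of the string `a` for the variable `u`:
`u^{i₁} ⋯ u^{i_m} ū^{i₁} ⋯ ū^{i_m}`. -/
def vblockA {m n : ℕ} (C : Fin n → Clause m) (u : Fin m) : List (Symb m n) :=
  ((clausesOf C u).map fun i => some (u, i, true)) ++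
    ((clausesOf C u).map fun i => some (u, i, false))

/-- The truth-setting block of the string `b` for the variable `u`:
`ū^{i₁} ⋯ ū^{i_m} u^{i₁} ⋯ u^{i_m}`. -/
def vblockB {m n : ℕ} (C : Fin n → Clause m) (u : Fin m) : List (Symb m n) :=
  ((clausesOf C u).map fun i => some (u, i, false)) ++
    ((clausesOf C u).map fun i => some (u, i, true))

/-- For a literal `x` of clause `c_i`, the symbol `x^i` (i.e. `u^i` if `x = u`
is positive, and `ū^i` if `x = ¬u`). -/
def litSym {m n : ℕ} (i : Fin n) (l : Lit m) : Symb m n := some (l.1, i, l.2)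

/-- For a literal `x` of clause `c_i`, the symbol `x̄^i` (i.e. `ū^i` if `x = u`
is positive, and `u^i` if `x = ¬u`). -/
def litSymBar {m n : ℕ} (i : Fin n) (l : Lit m) : Symb m n := some (l.1, i, !l.2)

/-- The satisfaction-testing block of `a` for clause `c_i = {x, y, z}`:
`x^i y^i z^i x̄^i ȳ^i z̄^i`. -/
def cblockA {m n : ℕ} (C : Fin n → Clause m) (i : Fin n) : List (Symb m n) :=
  [litSym i (C i).1, litSym i (C i).2.1, litSym i (C i).2.2,
   litSymBar i (C i).1, litSymBar i (C i).2.1, litSymBar i (C i).2.2]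

/-- The satisfaction-testing block of `b` for clause `c_i = {x, y, z}`:
`x^i y^i z^i ȳ^i x̄^i z̄^i ȳ^i`. -/
def cblockB {m n : ℕ} (C : Fin n → Clause m) (i : Fin n) : List (Symb m n) :=
  [litSym i (C i).1, litSym i (C i).2.1, litSym i (C i).2.2,
   litSymBar i (C i).2.1, litSymBar i (C i).1, litSymBar i (C i).2.2,
   litSymBar i (C i).2.1]

/-- The truth-setting part of the string `a`. -/
def truthA {m n : ℕ} (C : Fin n → Clause m) : List (Symb m n) :=
  ((List.finRange m).map (vblockA C)).flatten

/-- The truth-setting part of the string `b`. -/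
def truthB {m n : ℕ} (C : Fin n → Clause m) : List (Symb m n) :=
  ((List.finRange m).map (vblockB C)).flatten

/-- The satisfaction-testing part of the string `a`. -/
def testA {m n : ℕ} (C : Fin n → Clause m) : List (Symb m n) :=
  ((List.finRange n).map (cblockA C)).flatten

/-- The satisfaction-testing part of the string `b`. -/
def testB {m n : ℕ} (C : Fin n → Clause m) : List (Symb m n) :=
  ((List.finRange n).map (cblockB C)).flatten

/-- The string `a` of the reduction. -/
def strA {m n : ℕ} (C : Fin n → Clause m) : List (Symb m n) :=
  truthA C ++ [none] ++ testA C

/-- The string `b` of the reduction. -/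
def strB {m n : ℕ} (C : Fin n → Clause m) : List (Symb m n) :=
  truthB C ++ [none] ++ testB C

/-- The three literals of each clause involve three pairwise distinct variables
(`c_i` is a set of exactly three literals). -/
def ThreeDistinct {m n : ℕ} (C : Fin n → Clause m) : Prop :=
  ∀ i, (C i).1.1 ≠ (C i).2.1.1 ∧ (C i).1.1 ≠ (C i).2.2.1 ∧ (C i).2.1.1 ≠ (C i).2.2.1

/-- The literal `l` is true under the truth assignment `t`. -/
def LitTrue {m : ℕ} (t : Fin m → Bool) (l : Lit m) : Prop := t l.1 = l.2

/-- The truth assignment `t` satisfies every clause of `C`. -/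
def Satisfies {m n : ℕ} (t : Fin m → Bool) (C : Fin n → Clause m) : Prop :=
  ∀ i, LitTrue t (C i).1 ∨ LitTrue t (C i).2.1 ∨ LitTrue t (C i).2.2

/-- `p` is a permutation of the alphabet `Σ`: a string containing every symbol of `Σ`
exactly once. -/
def IsPermOfSigma {m n : ℕ} (C : Fin n → Clause m) (p : List (Symb m n)) : Prop :=
  p.Nodup ∧ ∀ s, s ∈ p ↔ InSigma C s

section Lists

variable {α β : Type*}

theorem flatten_map_sublist_flatten_map {f g : α → List β} (l : List α)
    (h : ∀ x, (f x).Sublist (g x)) : (l.map f).flatten.Sublist (l.map g).flatten := by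
  induction l with
  | nil => simp
  | cons a l ih => simpa using (h a).append ih

theorem filter_flatten_map (P : β → Bool) (f : α → List β) (l : List α) :
    (l.map f).flatten.filter P = (l.map fun x => (f x).filter P).flatten := by
  induction l with
  | nil => simp
  | cons a l ih => simp [ih]

/-- If only the block `f i` has elements satisfying `P`, then filtering the concatenation of
the blocks by `P` amounts to filtering `f i`. -/
theorem filter_flatten_map_eq_filter (P : β → Bool) (f : α → List β) {l : List α}
    (hl : l.Nodup) {i : α} (hi : i ∈ l) (h : ∀ j, j ≠ i → ∀ s ∈ f j, P s = false) :
    (l.map f).flatten.filter P = (f i).filter P := by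
  obtain ⟨l₁, l₂, rfl⟩ := List.append_of_mem hi
  have hnil : ∀ l' : List α, i ∉ l' → (l'.map f).flatten.filter P = [] := by
    intro l' hl'
    simp only [List.filter_eq_nil_iff, List.mem_flatten, List.mem_map]
    rintro s ⟨_, ⟨j, hj, rfl⟩, hs⟩
    simp [h j (fun e => hl' (e ▸ hj)) s hs]
  rw [List.nodup_middle, List.nodup_cons, List.mem_append, not_or] at hl
  simp [hnil _ hl.1.1, hnil _ hl.1.2]

theorem sublist_of_append_cons_sublist {x : α} {A B q₁ q₂ : List α} (hA : x ∉ A) (hB : x ∉ B)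
    (hq : x ∉ q₁) (h : (q₁ ++ x :: q₂).Sublist (A ++ x :: B)) :
    q₁.Sublist A ∧ q₂.Sublist B := by
  induction A generalizing q₁ with
  | nil =>
    cases q₁ with
    | nil => simpa using h
    | cons y q₁ =>
      cases h with
      | cons _ h => exact absurd (h.subset (by simp)) hB
      | cons_cons _ h => simp at hq
  | cons a A ih =>
    simp only [List.mem_cons, not_or] at hA
    cases q₁ with
    | nil =>
      cases h with
      | cons _ h => exact ⟨by simp, (ih hA.2 hq h).2⟩
      | cons_cons _ h => exact absurd rfl hA.1
    | cons y q₁ =>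
      cases h with
      | cons _ h => exact ⟨(ih hA.2 hq h).1.cons _, (ih hA.2 hq h).2⟩
      | cons_cons _ h =>
        have := ih hA.2 (fun hx => hq (by simp [hx])) h
        exact ⟨this.1.cons_cons _, this.2⟩

end Lists

section Reduction

variable {m n : ℕ} {C : Fin n → Clause m}

theorem mem_clausesOf {u : Fin m} {i : Fin n} : i ∈ clausesOf C u ↔ OccursIn C u i := by
  simp [clausesOf]

theorem nodup_clausesOf (u : Fin m) : (clausesOf C u).Nodup :=
  (List.nodup_finRange n).filter _

theorem mem_vblockA {u : Fin m} {s : Symb m n} :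
    s ∈ vblockA C u ↔ ∃ i b, OccursIn C u i ∧ s = some (u, i, b) := by
  simp only [vblockA, List.mem_append, List.mem_map, mem_clausesOf, Bool.exists_bool]
  grind

theorem mem_vblockB {u : Fin m} {s : Symb m n} :
    s ∈ vblockB C u ↔ ∃ i b, OccursIn C u i ∧ s = some (u, i, b) := by
  simp only [vblockB, List.mem_append, List.mem_map, mem_clausesOf, Bool.exists_bool]
  grind

theorem mem_truthA {s : Symb m n} : s ∈ truthA C ↔ s ≠ none ∧ InSigma C s := by
  rcases s with _ | ⟨u, i, b⟩ <;> simp [truthA, mem_vblockA, InSigma]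

theorem none_notMem_truthB : (none : Symb m n) ∉ truthB C := by
  simp [truthB, mem_vblockB]

theorem mem_cblockA {i : Fin n} {s : Symb m n} :
    s ∈ cblockA C i ↔ ∃ u b, OccursIn C u i ∧ s = some (u, i, b) := by
  simp only [cblockA, litSym, litSymBar, List.mem_cons, List.not_mem_nil, or_false]
  constructor
  · rintro (h | h | h | h | h | h) <;> exact ⟨_, _, by simp [OccursIn], h⟩
  · rintro ⟨u, b, rfl | rfl | rfl, rfl⟩
    · rcases Bool.eq_or_eq_not b (C i).1.2 with rfl | rfl <;> simp
    · rcases Bool.eq_or_eq_not b (C i).2.1.2 with rfl | rfl <;> simp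
    · rcases Bool.eq_or_eq_not b (C i).2.2.2 with rfl | rfl <;> simp

theorem mem_cblockB {i : Fin n} {s : Symb m n} : s ∈ cblockB C i ↔ s ∈ cblockA C i := by
  simp only [cblockA, cblockB, List.mem_cons, List.not_mem_nil, or_false]
  tauto

theorem mem_testA {s : Symb m n} : s ∈ testA C ↔ s ≠ none ∧ InSigma C s := by
  simp only [testA, List.mem_flatten, List.mem_map, List.mem_finRange, true_and,
    exists_exists_eq_and, mem_cblockA]
  rcases s with _ | ⟨u, i, b⟩
  · simp
  · constructor
    · rintro ⟨j, v, c, h, e⟩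
      obtain ⟨rfl, rfl, rfl⟩ : u = v ∧ i = j ∧ b = c := by simpa using e
      exact ⟨by simp, h⟩
    · exact fun h => ⟨i, u, b, h.2, rfl⟩

theorem none_notMem_testB : (none : Symb m n) ∉ testB C := by
  simp [testB, mem_cblockB, mem_cblockA]

theorem nodup_truthA : (truthA C).Nodup := by
  rw [truthA, List.nodup_flatten]
  constructor
  · simp only [List.mem_map]
    rintro _ ⟨u, -, rfl⟩
    refine List.Nodup.append ?_ ?_ ?_
    · exact (nodup_clausesOf u).map fun _ _ h => by simpa using h
    · exact (nodup_clausesOf u).map fun _ _ h => by simpa using h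
    · simp [List.Disjoint]
  · rw [List.pairwise_map]
    refine (List.nodup_finRange m).imp fun {u v} huv s hu hv => huv ?_
    rw [mem_vblockA] at hu hv
    grind

theorem nodup_testA (hC : ThreeDistinct C) : (testA C).Nodup := by
  rw [testA, List.nodup_flatten]
  constructor
  · simp only [List.mem_map]
    rintro _ ⟨i, -, rfl⟩
    obtain ⟨h₁, h₂, h₃⟩ := hC i
    simp [cblockA, litSym, litSymBar, h₁, h₂, h₃, h₁.symm, h₂.symm, h₃.symm]
  · rw [List.pairwise_map]
    refine (List.nodup_finRange n).imp fun {i j} hij s hi hj => hij ?_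
    rw [mem_cblockA] at hi hj
    grind

theorem pairwise_truthA :
    (truthA C).Pairwise fun s s' => ∀ u i j, ¬(s = some (u, i, false) ∧ s' = some (u, j, true)) := by
  rw [truthA, List.pairwise_flatten]
  constructor
  · simp only [List.mem_map]
    rintro _ ⟨u, -, rfl⟩
    simp only [vblockA, List.pairwise_append, List.pairwise_map, List.mem_map]
    refine ⟨?_, ?_, by grind⟩ <;> exact List.pairwise_of_forall (by simp)
  · rw [List.pairwise_map]
    refine (List.nodup_finRange m).imp fun {u v} huv s hs s' hs' w i j h => huv ?_
    rw [mem_vblockA] at hs hs'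
    grind

theorem pairwise_truthB :
    (truthB C).Pairwise fun s s' => ∀ u i j, ¬(s = some (u, i, true) ∧ s' = some (u, j, false)) := by
  rw [truthB, List.pairwise_flatten]
  constructor
  · simp only [List.mem_map]
    rintro _ ⟨u, -, rfl⟩
    simp only [vblockB, List.pairwise_append, List.pairwise_map, List.mem_map]
    refine ⟨?_, ?_, by grind⟩ <;> exact List.pairwise_of_forall (by simp)
  · rw [List.pairwise_map]
    refine (List.nodup_finRange m).imp fun {u v} huv s hs s' hs' w i j h => huv ?_
    rw [mem_vblockB] at hs hs'
    grind

/-- A common subsequence of the truth-setting parts uses only one polarity of each variable. -/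
theorem not_mem_both_polarities {q : List (Symb m n)} (hA : q.Sublist (truthA C))
    (hB : q.Sublist (truthB C)) {u : Fin m} {i j : Fin n} (hi : some (u, i, true) ∈ q)
    (hj : some (u, j, false) ∈ q) : False := by
  have hq : q.Pairwise fun s s' => ∀ u i j,
      ¬(s = some (u, i, false) ∧ s' = some (u, j, true)) ∧
      ¬(s = some (u, i, true) ∧ s' = some (u, j, false)) :=
    ((pairwise_truthA.sublist hA).and (pairwise_truthB.sublist hB)).imp
      fun h u i j => ⟨h.1 u i j, h.2 u i j⟩
  obtain ⟨k, hk, hik⟩ := List.getElem_of_mem hi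
  obtain ⟨l, hl, hjl⟩ := List.getElem_of_mem hj
  rw [List.pairwise_iff_getElem] at hq
  rcases lt_trichotomy k l with h | h | h
  · exact (hq k l hk hl h u i j).2 ⟨hik, hjl⟩
  · subst h
    simp [hik] at hjl
  · exact (hq l k hl hk h u j i).1 ⟨hjl, hik⟩

/-- A common subsequence of the satisfaction-testing parts omits one of the complementary
symbols of each clause. -/
theorem not_mem_all_litSymBar (hC : ThreeDistinct C) {q : List (Symb m n)}
    (hA : q.Sublist (testA C)) (hB : q.Sublist (testB C)) (i : Fin n)
    (hx : litSymBar i (C i).1 ∈ q) (hy : litSymBar i (C i).2.1 ∈ q)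
    (hz : litSymBar i (C i).2.2 ∈ q) : False := by
  obtain ⟨h₁, h₂, h₃⟩ := hC i
  set L : List (Symb m n) :=
    [litSymBar i (C i).1, litSymBar i (C i).2.1, litSymBar i (C i).2.2] with hL
  have hout : ∀ j, j ≠ i → ∀ s ∈ cblockA C j, decide (s ∈ L) = false := by
    intro j hj s hs
    obtain ⟨u, b, -, rfl⟩ := mem_cblockA.1 hs
    simp [hL, litSymBar, hj]
  have eA : (testA C).filter (· ∈ L) = L := by
    rw [testA, filter_flatten_map_eq_filter _ _ (List.nodup_finRange n) (List.mem_finRange i) hout]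
    simp [hL, cblockA, litSym, litSymBar, h₁, h₂, h₃, h₁.symm, h₂.symm, h₃.symm]
  have eB : (testB C).filter (· ∈ L) = [litSymBar i (C i).2.1, litSymBar i (C i).1,
      litSymBar i (C i).2.2, litSymBar i (C i).2.1] := by
    rw [testB, filter_flatten_map_eq_filter _ _ (List.nodup_finRange n) (List.mem_finRange i)
      fun j hj s hs => hout j hj s (mem_cblockB.1 hs)]
    simp [hL, cblockB, litSym, litSymBar, h₁, h₂, h₃, h₁.symm, h₂.symm, h₃.symm]
  have sA := hA.filter (· ∈ L)
  have sB := hB.filter (· ∈ L)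
  rw [eA] at sA
  rw [eB] at sB
  have hnd : L.Nodup := by simp [hL, litSymBar, h₁, h₂, h₃]
  have hsub : L ⊆ q.filter (· ∈ L) := by
    intro s hs
    have : s ∈ q := by
      simp only [hL, List.mem_cons, List.not_mem_nil, or_false] at hs
      rcases hs with rfl | rfl | rfl <;> assumption
    simp [this, hs]
  have hq : q.filter (· ∈ L) = L := sA.eq_of_length_le (hnd.subperm hsub).length_le
  rw [hq, hL] at sB
  simp [litSymBar, List.cons_sublist_cons', h₁, h₃, h₁.symm, h₃.symm] at sB

/-- Whether a symbol, read as a literal, is true under the assignment `t`. -/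
def symbTrue (t : Fin m → Bool) : Symb m n → Bool
  | none => false
  | some (u, _, b) => t u == b

theorem filter_truthA_sublist_truthB (t : Fin m → Bool) :
    ((truthA C).filter fun s => !symbTrue t s).Sublist (truthB C) := by
  rw [truthA, truthB, filter_flatten_map]
  refine flatten_map_sublist_flatten_map _ fun u => ?_
  cases h : t u <;>
    simp [vblockA, vblockB, List.filter_map, Function.comp_def, symbTrue, h]

theorem filter_testA_sublist_testB {t : Fin m → Bool} (ht : Satisfies t C) :
    ((testA C).filter (symbTrue t)).Sublist (testB C) := by
  rw [testA, testB, filter_flatten_map]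
  refine flatten_map_sublist_flatten_map _ fun i => ?_
  have h := ht i
  simp only [LitTrue] at h
  have hbar : ∀ l : Lit m, symbTrue t (litSymBar i l) = !symbTrue t (litSym i l) := by
    rintro ⟨u, b⟩
    cases hu : t u <;> cases b <;> simp [symbTrue, litSymBar, litSym, hu]
  have hlit : ∀ l : Lit m, t l.1 = l.2 ↔ symbTrue t (litSym i l) = true := by
    simp [symbTrue, litSym]
  simp only [hlit] at h
  cases hx : symbTrue t (litSym i (C i).1) <;> cases hy : symbTrue t (litSym i (C i).2.1) <;>
    cases hz : symbTrue t (litSym i (C i).2.2) <;>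
    simp [hx, hy, hz] at h <;>
    simp [cblockA, cblockB, hbar, hx, hy, hz, List.cons_sublist_cons']

theorem exists_satisfies_of_common_permutation (hC : ThreeDistinct C) {p : List (Symb m n)}
    (hp : IsPermOfSigma C p) (hA : p.Sublist (strA C)) (hB : p.Sublist (strB C)) :
    ∃ t : Fin m → Bool, Satisfies t C := by
  obtain ⟨hnd, hmem⟩ := hp
  obtain ⟨q₁, q₂, rfl⟩ := List.append_of_mem ((hmem none).2 trivial)
  have hnone : none ∉ q₁ := by
    rw [List.nodup_middle, List.nodup_cons, List.mem_append, not_or] at hnd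
    exact hnd.1.1
  simp only [strA, strB, List.append_assoc, List.singleton_append] at hA hB
  obtain ⟨hA₁, hA₂⟩ := sublist_of_append_cons_sublist (by simp [mem_truthA])
    (by simp [mem_testA]) hnone hA
  obtain ⟨hB₁, hB₂⟩ := sublist_of_append_cons_sublist none_notMem_truthB none_notMem_testB hnone hB
  classical
  refine ⟨fun u => decide (∃ i, some (u, i, false) ∈ q₁), fun i => ?_⟩
  have key : ∀ l : Lit m, litSymBar i l ∈ q₁ →
      LitTrue (fun u => decide (∃ i, some (u, i, false) ∈ q₁)) l := by
    rintro ⟨u, b⟩ h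
    cases b with
    | true => simpa [LitTrue] using ⟨i, by simpa [litSymBar] using h⟩
    | false =>
      simp only [LitTrue, decide_eq_false_iff_not]
      rintro ⟨j, hj⟩
      exact not_mem_both_polarities hA₁ hB₁ (by simpa [litSymBar] using h) hj
  have hcover : ∀ l : Lit m, OccursIn C l.1 i → litSymBar i l ∈ q₁ ∨ litSymBar i l ∈ q₂ := by
    intro l hl
    have := (hmem (litSymBar i l)).2 hl
    simpa [litSymBar] using this
  rcases hcover (C i).1 (by simp [OccursIn]) with h | hx
  · exact .inl (key _ h)
  rcases hcover (C i).2.1 (by simp [OccursIn]) with h | hy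
  · exact .inr (.inl (key _ h))
  rcases hcover (C i).2.2 (by simp [OccursIn]) with h | hz
  · exact .inr (.inr (key _ h))
  exact (not_mem_all_litSymBar hC hA₂ hB₂ i hx hy hz).elim

theorem exists_common_permutation_of_satisfies (hC : ThreeDistinct C) {t : Fin m → Bool}
    (ht : Satisfies t C) :
    ∃ p : List (Symb m n), IsPermOfSigma C p ∧ p.Sublist (strA C) ∧ p.Sublist (strB C) := by
  refine ⟨(truthA C).filter (fun s => !symbTrue t s) ++ [none] ++ (testA C).filter (symbTrue t),
    ⟨?_, fun s => ?_⟩, ?_, ?_⟩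
  · refine List.Nodup.append (List.Nodup.append (nodup_truthA.filter _) (by simp) ?_)
      ((nodup_testA hC).filter _) ?_
    · simp +contextual [List.Disjoint, mem_truthA]
    · intro s hs hs'
      simp only [List.mem_append, List.mem_filter, List.mem_singleton] at hs hs'
      rcases hs with hs | rfl
      · simp [hs'.2] at hs
      · simp [symbTrue] at hs'
  · rcases s with _ | s
    · simp [InSigma]
    · cases h : symbTrue t (some s) <;> simp [mem_truthA, mem_testA, h]
  · exact (List.filter_sublist.append_right _).append List.filter_sublist
  · exact ((filter_truthA_sublist_truthB t).append_right _).append (filter_testA_sublist_testB ht)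

end Reduction

/-- Theorem 2 of the paper, correctness of the reduction.
There exists a permutation of the alphabet `Σ` of the reduction which is a common
subsequence of the constructed strings `a` and `b` if and only if the 3SAT instance `C`
(with exactly three literals, on pairwise distinct variables, per clause) is
satisfiable. -/
theorem common_permutation_iff_satisfiable (m n : ℕ) (C : Fin n → Clause m)
    (hC : ThreeDistinct C) :
    (∃ p : List (Symb m n),
      IsPermOfSigma C p ∧ p.Sublist (strA C) ∧ p.Sublist (strB C)) ↔
    (∃ t : Fin m → Bool, Satisfies t C) := by
  constructor
  · rintro ⟨p, hp, hA, hB⟩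
    exact exists_satisfies_of_common_permutation hC hp hA hB
  · rintro ⟨t, ht⟩
    exact exists_common_permutation_of_satisfies hC ht

end CommonPerm
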